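/- (Coifman–Rochberg) Let Ω be either ℝ^n or a cube in ℝ^n with sides parallel to the axes. If f is a measurable function on Ω, not a.e. equal to zero, with M_Ω f(x) < ∞ for a.e. x ∈ Ω, and 0 < δ < 1, then the weight (M_Ω f)^δ belongs to A₁(Ω). -/

import Mathlib

open MeasureTheory ENNReal

/-- A (nondegenerate) cube in `ℝⁿ` with sides parallel to the axes. -/
def IsCube {n : ℕ} (Q : Set (Fin n → ℝ)) : Prop :=
  ∃ (a : Fin n → ℝ) (l : ℝ), 0 < l ∧
    Q = Set.univ.pi fun i => Set.Icc (a i) (a i + l)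

/-- The domains considered: all of `ℝⁿ` or a cube with sides parallel to the axes. -/
def IsAdmissibleDomain {n : ℕ} (Ω : Set (Fin n → ℝ)) : Prop :=
  Ω = Set.univ ∨ IsCube Ω

/-- The Hardy–Littlewood maximal operator restricted to `Ω`:
`M_Ω f (x) = sup { (1/|Q|) ∫_Q |f| : Q ⊆ Ω a cube with x ∈ Q }`. -/
noncomputable def maximal {n : ℕ} (Ω : Set (Fin n → ℝ)) (f : (Fin n → ℝ) → ℝ)
    (x : Fin n → ℝ) : ℝ≥0∞ :=
  ⨆ (Q : Set (Fin n → ℝ)) (_ : IsCube Q) (_ : Q ⊆ Ω) (_ : x ∈ Q),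
    (volume Q)⁻¹ * ∫⁻ y in Q, ENNReal.ofReal |f y|

/-- A weight on `Ω`: a measurable function, positive a.e. on `Ω`, integrable on every
cube contained in `Ω` (hence locally integrable; integrable when `Ω` is itself a cube). -/
structure IsWeight {n : ℕ} (Ω : Set (Fin n → ℝ)) (w : (Fin n → ℝ) → ℝ) : Prop where
  measurable : Measurable w
  pos : ∀ᵐ x ∂(volume.restrict Ω), 0 < w x
  locInt : ∀ Q : Set (Fin n → ℝ), IsCube Q → Q ⊆ Ω → IntegrableOn w Q

/-- The Muckenhoupt `A₁(Ω)` class: `M_Ω w ≤ C w` a.e. on `Ω`. -/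
def MemA1 {n : ℕ} (Ω : Set (Fin n → ℝ)) (w : (Fin n → ℝ) → ℝ) : Prop :=
  IsWeight Ω w ∧ ∃ C : ℝ, ∀ᵐ x ∂(volume.restrict Ω),
    maximal Ω w x ≤ ENNReal.ofReal (C * w x)

/-- The Muckenhoupt `A_p(Ω)` class for `1 < p < ∞`:
`sup_{Q ⊆ Ω} (avg_Q w) * (avg_Q w^(1-p'))^(p-1) < ∞` where `p' = p/(p-1)`. -/
def MemApGT1 {n : ℕ} (Ω : Set (Fin n → ℝ)) (p : ℝ) (w : (Fin n → ℝ) → ℝ) : Prop :=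
  IsWeight Ω w ∧ ∃ C : ℝ≥0∞, C ≠ ∞ ∧ ∀ Q : Set (Fin n → ℝ), IsCube Q → Q ⊆ Ω →
    ((volume Q)⁻¹ * ∫⁻ x in Q, ENNReal.ofReal (w x)) *
      ((volume Q)⁻¹ * ∫⁻ x in Q, ENNReal.ofReal (w x ^ (1 - p / (p - 1)))) ^ (p - 1) ≤ C

/-- The Muckenhoupt `A_p(Ω)` class for `1 ≤ p < ∞`. -/
def MemA {n : ℕ} (Ω : Set (Fin n → ℝ)) (p : ℝ) (w : (Fin n → ℝ) → ℝ) : Prop :=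
  (p = 1 ∧ MemA1 Ω w) ∨ (1 < p ∧ MemApGT1 Ω p w)

/-- The Muckenhoupt `A_∞(Ω)` class: the union of `A_p(Ω)` over `1 ≤ p < ∞`. -/
def MemAInf {n : ℕ} (Ω : Set (Fin n → ℝ)) (w : (Fin n → ℝ) → ℝ) : Prop :=
  ∃ p : ℝ, 1 ≤ p ∧ MemA Ω p w

/-- Membership in the weighted Lebesgue space `L^p_w(Ω)`: `f` measurable with
`∫_Ω |f|^p w < ∞`. -/
def MemLw {n : ℕ} (Ω : Set (Fin n → ℝ)) (p : ℝ) (w f : (Fin n → ℝ) → ℝ) : Prop :=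
  Measurable f ∧
    ∫⁻ x in Ω, ENNReal.ofReal |f x| ^ p * ENNReal.ofReal (w x) < ⊤

/-- Membership in the (unweighted) Lebesgue space `L^p(Ω)`. -/
def MemLeb {n : ℕ} (Ω : Set (Fin n → ℝ)) (p : ℝ) (f : (Fin n → ℝ) → ℝ) : Prop :=
  MemLw Ω p (fun _ => 1) f

/-- `f ∈ 𝓜_{A_p}(Ω)`: `f` is measurable and `|f| ≤ w` a.e. on `Ω` for some `w ∈ A_p(Ω)`. -/
def HasApMajorant {n : ℕ} (Ω : Set (Fin n → ℝ)) (p : ℝ) (f : (Fin n → ℝ) → ℝ) : Prop :=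
  Measurable f ∧ ∃ w, MemA Ω p w ∧ ∀ᵐ x ∂(volume.restrict Ω), |f x| ≤ w x

/-- `f ∈ 𝓜^r_{A_p}(Ω)`: `f` is measurable and `|f|^r ≤ w` a.e. on `Ω` for some
`w ∈ A_p(Ω)`. -/
def HasApPowMajorant {n : ℕ} (Ω : Set (Fin n → ℝ)) (p r : ℝ) (f : (Fin n → ℝ) → ℝ) : Prop :=
  Measurable f ∧ ∃ w, MemA Ω p w ∧ ∀ᵐ x ∂(volume.restrict Ω), |f x| ^ r ≤ w x

/-- `f ∈ 𝓜_{A_∞}(Ω)`: `f` is measurable and `|f| ≤ w` a.e. on `Ω` for some `w ∈ A_∞(Ω)`. -/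
def HasAInfMajorant {n : ℕ} (Ω : Set (Fin n → ℝ)) (f : (Fin n → ℝ) → ℝ) : Prop :=
  Measurable f ∧ ∃ w, MemAInf Ω w ∧ ∀ᵐ x ∂(volume.restrict Ω), |f x| ≤ w x

/-- Membership in weak `L^p(ℝⁿ)`: `sup_{t>0} t · |{|f| > t}|^{1/p} < ∞`. -/
def MemWeakLp {n : ℕ} (p : ℝ) (f : (Fin n → ℝ) → ℝ) : Prop :=
  Measurable f ∧ ∃ C : ℝ≥0∞, C ≠ ⊤ ∧ ∀ t : ℝ, 0 < t →
    ENNReal.ofReal t * volume {x | t < |f x|} ^ (1 / p) ≤ C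

open Metric Set Filter Topology

theorem isCube_iff_exists_closedBall {n : ℕ} {Q : Set (Fin n → ℝ)} :
    IsCube Q ↔ ∃ (c : Fin n → ℝ) (r : ℝ), 0 < r ∧ Q = closedBall c r := by
  constructor
  · rintro ⟨a, l, hl, rfl⟩
    refine ⟨fun i => a i + l / 2, l / 2, by positivity, ?_⟩
    rw [closedBall_pi _ (by positivity)]
    refine congrArg _ (funext fun i => ?_)
    rw [Real.closedBall_eq_Icc]
    congr 1 <;> ring
  · rintro ⟨c, r, hr, rfl⟩
    refine ⟨fun i => c i - r, 2 * r, by positivity, ?_⟩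
    rw [closedBall_pi _ hr.le]
    refine congrArg _ (funext fun i => ?_)
    rw [Real.closedBall_eq_Icc]
    congr 1; ring

theorem isCube_closedBall {n : ℕ} (c : Fin n → ℝ) {r : ℝ} (hr : 0 < r) :
    IsCube (closedBall c r) :=
  isCube_iff_exists_closedBall.2 ⟨c, r, hr, rfl⟩

theorem volume_closedBall_fin {n : ℕ} (c : Fin n → ℝ) {r : ℝ} (hr : 0 < r) :
    volume (closedBall c r) = ENNReal.ofReal ((2 * r) ^ n) := by
  rw [Real.volume_pi_closedBall _ hr.le, Fintype.card_fin]

theorem volume_closedBall_fin_ne_zero {n : ℕ} (c : Fin n → ℝ) {r : ℝ} (hr : 0 < r) :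
    volume (closedBall c r) ≠ 0 := by
  rw [volume_closedBall_fin c hr, Ne, ENNReal.ofReal_eq_zero, not_le]; positivity

theorem volume_closedBall_fin_ne_top {n : ℕ} (c : Fin n → ℝ) {r : ℝ} (hr : 0 < r) :
    volume (closedBall c r) ≠ ⊤ := by
  rw [volume_closedBall_fin c hr]; exact ENNReal.ofReal_ne_top

theorem volume_closedBall_le_mul {n : ℕ} (c d : Fin n → ℝ) {r s k : ℝ} (hr : 0 < r) (hs : 0 < s)
    (hk : 0 ≤ k) (h : r ≤ k * s) :
    volume (closedBall c r) ≤ ENNReal.ofReal (k ^ n) * volume (closedBall d s) := by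
  rw [volume_closedBall_fin c hr, volume_closedBall_fin d hs,
    ← ENNReal.ofReal_mul (by positivity), ← mul_pow]
  refine ENNReal.ofReal_le_ofReal (pow_le_pow_left₀ (by positivity) (by linarith) _)

theorem IsAdmissibleDomain.measurableSet {n : ℕ} {Ω : Set (Fin n → ℝ)}
    (hΩ : IsAdmissibleDomain Ω) : MeasurableSet Ω := by
  rcases hΩ with rfl | h
  · exact MeasurableSet.univ
  · obtain ⟨c, r, -, rfl⟩ := isCube_iff_exists_closedBall.1 h
    exact isClosed_closedBall.measurableSet

/-- The part of a cube lying in an admissible domain is covered by a cube of the domain which is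
not larger. -/
theorem IsAdmissibleDomain.exists_closedBall {n : ℕ} {Ω : Set (Fin n → ℝ)}
    (hΩ : IsAdmissibleDomain Ω) (c : Fin n → ℝ) {ρ : ℝ} (hρ : 0 < ρ) :
    ∃ (c' : Fin n → ℝ) (r' : ℝ), 0 < r' ∧ r' ≤ ρ ∧ closedBall c' r' ⊆ Ω ∧
      Ω ∩ closedBall c ρ ⊆ closedBall c' r' := by
  rcases hΩ with rfl | h
  · exact ⟨c, ρ, hρ, le_rfl, subset_univ _, inter_subset_right⟩
  obtain ⟨b, L, hL, rfl⟩ := isCube_iff_exists_closedBall.1 h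
  rcases le_or_gt L ρ with hLρ | hLρ
  · exact ⟨b, L, hL, hLρ, Subset.rfl, inter_subset_left⟩
  refine ⟨fun i => max (b i - (L - ρ)) (min (c i) (b i + (L - ρ))), ρ, hρ, le_rfl, ?_, ?_⟩
  · refine closedBall_subset_closedBall' ?_
    suffices dist (fun i => max (b i - (L - ρ)) (min (c i) (b i + (L - ρ)))) b ≤ L - ρ by linarith
    refine (dist_pi_le_iff (by linarith)).2 fun i => ?_
    rw [Real.dist_eq, abs_le]
    constructor
    · linarith [le_max_left (b i - (L - ρ)) (min (c i) (b i + (L - ρ)))]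
    · have : max (b i - (L - ρ)) (min (c i) (b i + (L - ρ))) ≤ b i + (L - ρ) :=
        max_le (by linarith) (min_le_right _ _)
      linarith
  · rintro z ⟨hzb, hzc⟩
    rw [mem_closedBall, dist_pi_le_iff (by positivity)] at hzb hzc ⊢
    intro i
    have h1 := abs_le.1 (Real.dist_eq _ _ ▸ hzb i)
    have h2 := abs_le.1 (Real.dist_eq _ _ ▸ hzc i)
    rw [Real.dist_eq, abs_le]
    rcases max_cases (b i - (L - ρ)) (min (c i) (b i + (L - ρ))) with h3 | h3 <;>
      rcases min_cases (c i) (b i + (L - ρ)) with h4 | h4 <;> constructor <;> linarith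

theorem lt_maximal_iff {n : ℕ} {Ω : Set (Fin n → ℝ)} {f : (Fin n → ℝ) → ℝ} {x : Fin n → ℝ}
    {t : ℝ≥0∞} :
    t < maximal Ω f x ↔ ∃ (c : Fin n → ℝ) (r : ℝ), 0 < r ∧ closedBall c r ⊆ Ω ∧
      x ∈ closedBall c r ∧
      t < (volume (closedBall c r))⁻¹ * ∫⁻ y in closedBall c r, ENNReal.ofReal |f y| := by
  simp only [maximal, lt_iSup_iff]
  constructor
  · rintro ⟨Q, hQ, h1, h2, h3⟩
    obtain ⟨c, r, hr, rfl⟩ := isCube_iff_exists_closedBall.1 hQ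
    exact ⟨c, r, hr, h1, h2, h3⟩
  · rintro ⟨c, r, hr, h1, h2, h3⟩
    exact ⟨_, isCube_closedBall c hr, h1, h2, h3⟩

theorem average_le_maximal {n : ℕ} {Ω : Set (Fin n → ℝ)} (f : (Fin n → ℝ) → ℝ) {x c : Fin n → ℝ}
    {r : ℝ} (hr : 0 < r) (h : closedBall c r ⊆ Ω) (hx : x ∈ closedBall c r) :
    (volume (closedBall c r))⁻¹ * ∫⁻ y in closedBall c r, ENNReal.ofReal |f y|
      ≤ maximal Ω f x :=
  le_of_forall_lt fun _ ht => lt_maximal_iff.2 ⟨c, r, hr, h, hx, ht⟩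

theorem lintegral_closedBall_le_maximal {n : ℕ} {Ω : Set (Fin n → ℝ)} (f : (Fin n → ℝ) → ℝ)
    {x c : Fin n → ℝ} {r : ℝ} (hr : 0 < r) (h : closedBall c r ⊆ Ω) (hx : x ∈ closedBall c r) :
    ∫⁻ y in closedBall c r, ENNReal.ofReal |f y|
      ≤ volume (closedBall c r) * maximal Ω f x := by
  have := average_le_maximal f hr h hx
  rwa [mul_comm, ← div_eq_mul_inv, ENNReal.div_le_iff' (volume_closedBall_fin_ne_zero c hr)
    (volume_closedBall_fin_ne_top c hr)] at this

theorem measurable_maximal {n : ℕ} {Ω : Set (Fin n → ℝ)} (hΩ : IsAdmissibleDomain Ω)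
    (f : (Fin n → ℝ) → ℝ) : Measurable (maximal Ω f) := by
  refine measurable_of_Ioi fun t => ?_
  set S : Set (Fin n → ℝ) := maximal Ω f ⁻¹' Ioi t
  have key : S = Ω ∩ ⋃₀ {B | IsOpen B ∧ Ω ∩ B ⊆ S} := by
    apply Subset.antisymm
    · intro x hx
      obtain ⟨c, r, hr, hsub, hxr, ht⟩ := lt_maximal_iff.1 hx
      refine ⟨hsub hxr, ?_⟩
      have hlim : Tendsto (fun ρ : ℝ => (ENNReal.ofReal ((2 * ρ) ^ n))⁻¹ *
          ∫⁻ y in closedBall c r, ENNReal.ofReal |f y|) (𝓝[>] r)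
          (𝓝 ((ENNReal.ofReal ((2 * r) ^ n))⁻¹ *
            ∫⁻ y in closedBall c r, ENNReal.ofReal |f y|)) := by
        refine ENNReal.Tendsto.mul_const ?_ (Or.inl (by simp))
        have : Continuous fun ρ : ℝ => (ENNReal.ofReal ((2 * ρ) ^ n))⁻¹ :=
          (ENNReal.continuous_ofReal.comp (by fun_prop)).inv
        exact this.continuousWithinAt
      rw [← volume_closedBall_fin c hr] at hlim
      obtain ⟨ρ, hρt, hρ⟩ := ((hlim.eventually (lt_mem_nhds ht)).and self_mem_nhdsWithin).exists
      have hrρ : r < ρ := hρ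
      have hρ0 : 0 < ρ := hr.trans hrρ
      refine ⟨ball c ρ, ⟨isOpen_ball, ?_⟩, closedBall_subset_ball hrρ hxr⟩
      rintro z ⟨hzΩ, hz⟩
      obtain ⟨c', r', hr', hle, hsub', hcov⟩ := hΩ.exists_closedBall c hρ0
      refine lt_maximal_iff.2 ⟨c', r', hr', hsub', hcov ⟨hzΩ, ball_subset_closedBall hz⟩,
        hρt.trans_le ?_⟩
      refine mul_le_mul' (ENNReal.inv_le_inv.2 ?_) (lintegral_mono_set fun y hy =>
        hcov ⟨hsub hy, closedBall_subset_closedBall hrρ.le hy⟩)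
      rw [volume_closedBall_fin c' hr']
      exact ENNReal.ofReal_le_ofReal (pow_le_pow_left₀ (by positivity) (by linarith) _)
    · rintro x ⟨hxΩ, B, ⟨-, hB⟩, hxB⟩
      exact hB ⟨hxΩ, hxB⟩
  rw [key]
  exact hΩ.measurableSet.inter (isOpen_sUnion fun B hB => hB.1).measurableSet

/-- The weak type `(1,1)` inequality for the maximal operator restricted to a cube. -/
theorem mul_volume_lt_maximal_le {n : ℕ} (b : Fin n → ℝ) {L : ℝ} (hL : 0 < L)
    (f : (Fin n → ℝ) → ℝ) (t : ℝ≥0∞) :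
    t * volume {x | t < maximal (closedBall b L) f x}
      ≤ ENNReal.ofReal (5 ^ n) * ∫⁻ y in closedBall b L, ENNReal.ofReal |f y| := by
  let T : Set ((Fin n → ℝ) × ℝ) := {p | 0 < p.2 ∧ closedBall p.1 p.2 ⊆ closedBall b L ∧
    t < (volume (closedBall p.1 p.2))⁻¹ * ∫⁻ y in closedBall p.1 p.2, ENNReal.ofReal |f y|}
  by_cases hn : n = 0
  · subst hn
    by_cases hE : (∃ x, t < maximal (closedBall b L) f x)
    · obtain ⟨x, hx⟩ := hE
      obtain ⟨c, r, hr, hsub, hxr, ht⟩ := lt_maximal_iff.1 hx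
      have h1 : closedBall c r = univ := Subsingleton.eq_univ_of_nonempty ⟨x, hxr⟩
      have h2 : closedBall b L = univ :=
        Subsingleton.eq_univ_of_nonempty ⟨b, mem_closedBall_self hL.le⟩
      have h3 : volume (univ : Set (Fin 0 → ℝ)) = 1 := by
        rw [← h1, volume_closedBall_fin c hr]; simp
      rw [h1, h3] at ht
      rw [h2]
      simp only [inv_one, one_mul] at ht
      calc _ ≤ t * 1 := by gcongr; exact (measure_mono (subset_univ _)).trans h3.le
        _ ≤ _ := by simpa using ht.le
    · push Not at hE
      have : {x | t < maximal (closedBall b L) f x} = ∅ := by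
        ext x; simpa using hE x
      rw [this]; simp
  have hTL : ∀ p ∈ T, p.2 ≤ L := by
    rintro ⟨c, r⟩ ⟨hr, hsub, -⟩
    have := measure_mono (μ := volume) hsub
    rw [volume_closedBall_fin c hr, volume_closedBall_fin b hL,
      ENNReal.ofReal_le_ofReal_iff (by positivity),
      pow_le_pow_iff_left₀ (by positivity) (by positivity) hn] at this
    linarith
  obtain ⟨u, huT, hdisj, hcov⟩ := Vitali.exists_disjoint_subfamily_covering_enlargement_closedBall
    T Prod.fst Prod.snd L hTL 5 (by norm_num)
  have hcount : u.Countable := by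
    refine Set.PairwiseDisjoint.countable_of_nonempty_interior hdisj fun p hp => ?_
    exact ⟨p.1, ball_subset_interior_closedBall (mem_ball_self (huT hp).1)⟩
  have hsubset : {x | t < maximal (closedBall b L) f x} ⊆ ⋃ p ∈ u, closedBall p.1 (5 * p.2) := by
    intro x hx
    obtain ⟨c, r, hr, hsub, hxr, ht⟩ := lt_maximal_iff.1 hx
    obtain ⟨p, hp, hcp⟩ := hcov (c, r) ⟨hr, hsub, ht⟩
    exact mem_biUnion hp (hcp hxr)
  calc t * volume {x | t < maximal (closedBall b L) f x}
      ≤ t * ∑' p : u, volume (closedBall p.1.1 (5 * p.1.2)) := by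
        gcongr
        exact (measure_mono hsubset).trans (measure_biUnion_le _ hcount _)
    _ = ∑' p : u, t * volume (closedBall p.1.1 (5 * p.1.2)) := ENNReal.tsum_mul_left.symm
    _ ≤ ∑' p : u, ENNReal.ofReal (5 ^ n) *
          ∫⁻ y in closedBall p.1.1 p.1.2, ENNReal.ofReal |f y| := by
        refine ENNReal.tsum_le_tsum fun p => ?_
        obtain ⟨hr, -, ht⟩ := huT p.2
        have h1 := volume_closedBall_le_mul p.1.1 p.1.1 (r := 5 * p.1.2) (k := 5)
          (by positivity) hr (by norm_num) le_rfl
        have h2 : t * volume (closedBall p.1.1 p.1.2) ≤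
            ∫⁻ y in closedBall p.1.1 p.1.2, ENNReal.ofReal |f y| := by
          rw [mul_comm, ← div_eq_mul_inv] at ht
          exact ENNReal.mul_le_of_le_div ht.le
        calc t * volume (closedBall p.1.1 (5 * p.1.2))
            ≤ t * (ENNReal.ofReal (5 ^ n) * volume (closedBall p.1.1 p.1.2)) := by gcongr
          _ = ENNReal.ofReal (5 ^ n) * (t * volume (closedBall p.1.1 p.1.2)) := by ring
          _ ≤ _ := by gcongr
    _ = ENNReal.ofReal (5 ^ n) *
          ∫⁻ y in ⋃ p ∈ u, closedBall p.1 p.2, ENNReal.ofReal |f y| := by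
        rw [ENNReal.tsum_mul_left, lintegral_biUnion hcount
          (fun p _ => isClosed_closedBall.measurableSet) hdisj]
    _ ≤ _ := by
        gcongr
        exact iUnion₂_subset fun p hp => (huT hp).2.1

/-- Kolmogorov's inequality: a weak type bound for large levels controls the integral of a power
less than one. -/
theorem lintegral_rpow_le_of_weak_bound {α : Type*} [MeasurableSpace α] (μ : Measure α)
    {h : α → ℝ} (hh : Measurable h) (h0 : ∀ x, 0 ≤ h x) {V : ℝ≥0∞} {A K δ : ℝ} (hA : 0 < A)
    (hK : 0 ≤ K) (hδ0 : 0 < δ) (hδ1 : δ < 1) (hV : μ univ ≤ V)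
    (hweak : ∀ t, A < t → μ {x | t < h x} ≤ V * ENNReal.ofReal (K * A / t)) :
    ∫⁻ x, ENNReal.ofReal (h x ^ δ) ∂μ
      ≤ V * ENNReal.ofReal ((1 + δ * K / (1 - δ)) * A ^ δ) := by
  have hδ2 : 0 < 1 - δ := by linarith
  rw [lintegral_rpow_eq_lintegral_meas_lt_mul μ (Eventually.of_forall h0) hh.aemeasurable hδ0,
    ← Ioc_union_Ioi_eq_Ioi hA.le]
  have hsmall : ∫⁻ t in Ioc 0 A, μ {x | t < h x} * ENNReal.ofReal (t ^ (δ - 1))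
      ≤ V * ENNReal.ofReal (A ^ δ / δ) := by
    calc _ ≤ ∫⁻ t in Ioc 0 A, V * ENNReal.ofReal (t ^ (δ - 1)) := by
          gcongr
          exact (measure_mono (subset_univ _)).trans hV
      _ = V * ∫⁻ t in Ioc 0 A, ENNReal.ofReal (t ^ (δ - 1)) :=
          lintegral_const_mul _ (by fun_prop)
      _ = _ := by
          rw [← ofReal_integral_eq_lintegral_ofReal]
          · rw [← intervalIntegral.integral_of_le hA.le, integral_rpow (Or.inl (by linarith))]
            simp [Real.zero_rpow hδ0.ne']
          · exact (intervalIntegrable_iff_integrableOn_Ioc_of_le hA.le).1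
              (intervalIntegral.intervalIntegrable_rpow' (by linarith))
          · filter_upwards [ae_restrict_mem measurableSet_Ioc] with t ht
            exact Real.rpow_nonneg ht.1.le _
  have hlarge : ∫⁻ t in Ioi A, μ {x | t < h x} * ENNReal.ofReal (t ^ (δ - 1))
      ≤ V * ENNReal.ofReal (K * A ^ δ / (1 - δ)) := by
    calc _ ≤ ∫⁻ t in Ioi A, V * ENNReal.ofReal (K * A * t ^ (δ - 2)) := by
          refine setLIntegral_mono' measurableSet_Ioi fun t ht => ?_
          have ht0 : 0 < t := hA.trans ht
          calc _ ≤ V * ENNReal.ofReal (K * A / t) * ENNReal.ofReal (t ^ (δ - 1)) := by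
                gcongr; exact hweak t ht
            _ = _ := by
                have hpow : t ^ (δ - 2) = t ^ (δ - 1) / t := by
                  rw [← Real.rpow_sub_one ht0.ne']; ring_nf
                rw [mul_assoc, ← ENNReal.ofReal_mul (by positivity), hpow]
                congr 2; ring
      _ = V * ∫⁻ t in Ioi A, ENNReal.ofReal (K * A * t ^ (δ - 2)) :=
          lintegral_const_mul _ (by fun_prop)
      _ = _ := by
          rw [← ofReal_integral_eq_lintegral_ofReal]
          · rw [integral_const_mul, integral_Ioi_rpow_of_lt (by linarith) hA,
              show δ - 2 + 1 = δ - 1 by ring, Real.rpow_sub_one hA.ne']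
            congr 2
            rw [← neg_sub 1 δ]
            field_simp
          · exact (integrableOn_Ioi_rpow_of_lt (by linarith) hA).const_mul _
          · filter_upwards [ae_restrict_mem measurableSet_Ioi] with t ht
            have ht0 : 0 < t := hA.trans ht
            positivity
  calc _ ≤ ENNReal.ofReal δ * (V * ENNReal.ofReal (A ^ δ / δ) +
          V * ENNReal.ofReal (K * A ^ δ / (1 - δ))) := by
        gcongr
        exact (lintegral_union_le _ _ _).trans (add_le_add hsmall hlarge)
    _ = _ := by
        rw [← mul_add, ← ENNReal.ofReal_add (by positivity) (by positivity), mul_left_comm,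
          ← ENNReal.ofReal_mul hδ0.le]
        congr 2
        field_simp

theorem maximal_pos {n : ℕ} {Ω : Set (Fin n → ℝ)} (hΩ : IsAdmissibleDomain Ω)
    {f : (Fin n → ℝ) → ℝ} (hf : Measurable f) (hne : ¬ (∀ᵐ x ∂(volume.restrict Ω), f x = 0))
    {x : Fin n → ℝ} (hx : x ∈ Ω) : 0 < maximal Ω f x := by
  by_contra hcon
  have hzero : maximal Ω f x = 0 := by simpa using hcon
  refine hne ?_
  have hcover : ∀ k : ℕ, ∫⁻ y in Ω ∩ closedBall x (k + 1), ENNReal.ofReal |f y| = 0 := by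
    intro k
    have hk : (0 : ℝ) < k + 1 := by positivity
    obtain ⟨c, r, hr, -, hsub, hcov⟩ := hΩ.exists_closedBall x hk
    have h1 := lintegral_closedBall_le_maximal f hr hsub (hcov ⟨hx, mem_closedBall_self hk.le⟩)
    rw [hzero, mul_zero] at h1
    exact le_antisymm ((lintegral_mono_set hcov).trans h1) zero_le
  have hunion : Ω = ⋃ k : ℕ, Ω ∩ closedBall x (k + 1) := by
    rw [← inter_iUnion, eq_comm, inter_eq_left]
    intro y _
    obtain ⟨k, hk⟩ := exists_nat_ge (dist y x)
    exact mem_iUnion.2 ⟨k, mem_closedBall.2 (by linarith)⟩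
  rw [hunion, ae_restrict_iUnion_iff]
  intro k
  have h2 := (lintegral_eq_zero_iff (by fun_prop)).1 (hcover k)
  filter_upwards [h2] with y hy
  simpa using hy

/-- Large values of the maximal function on a cube come from a comparable cube. -/
theorem exists_closedBall_maximal_le_max {n : ℕ} {Ω : Set (Fin n → ℝ)} (hΩ : IsAdmissibleDomain Ω)
    (f : (Fin n → ℝ) → ℝ) {c y : Fin n → ℝ} {r : ℝ} (hr : 0 < r) (hsub : closedBall c r ⊆ Ω)
    (hy : y ∈ closedBall c r) :
    ∃ (b : Fin n → ℝ) (L : ℝ), 0 < L ∧ L ≤ 3 * r ∧ closedBall b L ⊆ Ω ∧ y ∈ closedBall b L ∧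
      ∀ x ∈ closedBall c r, maximal Ω f x ≤
        max (maximal (closedBall b L) f x) (ENNReal.ofReal (3 ^ n) * maximal Ω f y) := by
  obtain ⟨b, L, hL, hLr, hbΩ, hcov⟩ := hΩ.exists_closedBall c (ρ := 3 * r) (by positivity)
  refine ⟨b, L, hL, hLr, hbΩ,
    hcov ⟨hsub hy, closedBall_subset_closedBall (by linarith) hy⟩, fun x hx => ?_⟩
  refine le_of_forall_lt fun t ht => ?_
  obtain ⟨d, s, hs, hdΩ, hxd, ht⟩ := lt_maximal_iff.1 ht
  by_cases hd : closedBall d s ⊆ closedBall b L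
  · exact lt_max_of_lt_left (lt_maximal_iff.2 ⟨d, s, hs, hd, hxd, ht⟩)
  refine lt_max_of_lt_right (ht.trans_le ?_)
  obtain ⟨z, hzd, hzb⟩ := not_subset.1 hd
  have hzc : 3 * r < dist z c := by
    by_contra! h
    exact hzb (hcov ⟨hdΩ hzd, h⟩)
  rw [mem_closedBall] at hx hy hxd hzd
  have hrs : r < s := by
    linarith [dist_triangle4 z d x c, dist_comm d x]
  obtain ⟨e, ℓ, hℓ, hℓs, heΩ, hcov'⟩ := hΩ.exists_closedBall d (ρ := 3 * s) (by positivity)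
  have hye : y ∈ closedBall e ℓ := by
    refine hcov' ⟨hsub hy, ?_⟩
    rw [mem_closedBall]
    linarith [dist_triangle4 y c x d, dist_comm c x]
  have h1 : ∫⁻ y in closedBall d s, ENNReal.ofReal |f y| ≤
      ENNReal.ofReal (3 ^ n) * volume (closedBall d s) * maximal Ω f y := by
    calc _ ≤ ∫⁻ y in closedBall e ℓ, ENNReal.ofReal |f y| := lintegral_mono_set fun w hw =>
          hcov' ⟨hdΩ hw, closedBall_subset_closedBall (by linarith) hw⟩
      _ ≤ volume (closedBall e ℓ) * maximal Ω f y :=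
          lintegral_closedBall_le_maximal f hℓ heΩ hye
      _ ≤ _ := by
          gcongr
          exact volume_closedBall_le_mul e d hℓ hs (by norm_num) hℓs
  rw [mul_comm, ← div_eq_mul_inv]
  refine ENNReal.div_le_of_le_mul (h1.trans_eq (by ring))

theorem lintegral_maximal_rpow_le {n : ℕ} {Ω : Set (Fin n → ℝ)} (hΩ : IsAdmissibleDomain Ω)
    {f : (Fin n → ℝ) → ℝ} (hf : Measurable f) (hne : ¬ (∀ᵐ x ∂(volume.restrict Ω), f x = 0))
    {δ : ℝ} (hδ0 : 0 < δ) (hδ1 : δ < 1) {c y : Fin n → ℝ} {r : ℝ} (hr : 0 < r)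
    (hsub : closedBall c r ⊆ Ω) (hy : y ∈ closedBall c r) (hfin : maximal Ω f y < ⊤) :
    ∫⁻ x in closedBall c r, ENNReal.ofReal ((maximal Ω f x).toReal ^ δ) ≤
      volume (closedBall c r) * ENNReal.ofReal
        ((1 + δ * 5 ^ n / (1 - δ)) * (3 ^ n * (maximal Ω f y).toReal) ^ δ) := by
  have hpos : 0 < (maximal Ω f y).toReal :=
    ENNReal.toReal_pos (maximal_pos hΩ hf hne (hsub hy)).ne' hfin.ne
  have hA : ENNReal.ofReal (3 ^ n) * maximal Ω f y =
      ENNReal.ofReal (3 ^ n * (maximal Ω f y).toReal) := by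
    rw [ENNReal.ofReal_mul (by positivity), ENNReal.ofReal_toReal hfin.ne]
  obtain ⟨b, L, hL, hLr, hbΩ, hyb, hmax⟩ := exists_closedBall_maximal_le_max hΩ f hr hsub hy
  refine lintegral_rpow_le_of_weak_bound _ (measurable_maximal hΩ f).ennreal_toReal
    (fun _ => ENNReal.toReal_nonneg) (by positivity) (by positivity) hδ0 hδ1 (by simp) ?_
  intro t ht
  have ht0 : 0 < t := lt_trans (by positivity) ht
  have hsubset : {x | t < (maximal Ω f x).toReal} ∩ closedBall c r ⊆
      {x | ENNReal.ofReal t < maximal (closedBall b L) f x} := by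
    rintro x ⟨hx, hxc⟩
    have h1 : ENNReal.ofReal t < maximal Ω f x :=
      (ENNReal.ofReal_lt_ofReal_iff_of_nonneg ht0.le).2 hx |>.trans_le ENNReal.ofReal_toReal_le
    refine (lt_max_iff.1 (h1.trans_le (hmax x hxc))).resolve_right ?_
    rw [hA, not_lt]
    exact ENNReal.ofReal_le_ofReal ht.le
  rw [Measure.restrict_apply'
    isClosed_closedBall.measurableSet]
  have h2 : ENNReal.ofReal t * volume ({x | t < (maximal Ω f x).toReal} ∩ closedBall c r) ≤
      volume (closedBall c r) *
        ENNReal.ofReal (5 ^ n * (3 ^ n * (maximal Ω f y).toReal)) := by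
    calc _ ≤ ENNReal.ofReal t * volume {x | ENNReal.ofReal t < maximal (closedBall b L) f x} := by
          gcongr
      _ ≤ ENNReal.ofReal (5 ^ n) * ∫⁻ y in closedBall b L, ENNReal.ofReal |f y| :=
          mul_volume_lt_maximal_le b hL f _
      _ ≤ ENNReal.ofReal (5 ^ n) * (volume (closedBall b L) * maximal Ω f y) := by
          gcongr
          exact lintegral_closedBall_le_maximal f hL hbΩ hyb
      _ ≤ ENNReal.ofReal (5 ^ n) *
            (ENNReal.ofReal (3 ^ n) * volume (closedBall c r) * maximal Ω f y) := by
          gcongr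
          exact volume_closedBall_le_mul b c hL hr (by norm_num) hLr
      _ = _ := by
          rw [ENNReal.ofReal_mul (p := 5 ^ n) (by positivity), ← hA]; ring
  rw [ENNReal.ofReal_div_of_pos ht0, ← mul_div_assoc, ENNReal.le_div_iff_mul_le
    (Or.inl (by simpa using ht0)) (Or.inl ENNReal.ofReal_ne_top), mul_comm]
  exact h2

theorem stmt14 (n : ℕ) (Ω : Set (Fin n → ℝ)) (hΩ : IsAdmissibleDomain Ω)
    (f : (Fin n → ℝ) → ℝ) (hf : Measurable f)
    (hne : ¬ (∀ᵐ x ∂(volume.restrict Ω), f x = 0))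
    (hfin : ∀ᵐ x ∂(volume.restrict Ω), maximal Ω f x < ⊤)
    (δ : ℝ) (hδ0 : 0 < δ) (hδ1 : δ < 1) :
    MemA1 Ω (fun x => (maximal Ω f x).toReal ^ δ) := by
  have hmeas : Measurable fun x => (maximal Ω f x).toReal ^ δ :=
    (measurable_maximal hΩ f).ennreal_toReal.pow_const δ
  refine ⟨⟨hmeas, ?_, ?_⟩, (1 + δ * 5 ^ n / (1 - δ)) * (3 ^ n) ^ δ, ?_⟩
  · filter_upwards [hfin, ae_restrict_mem hΩ.measurableSet] with x hx hxΩ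
    exact Real.rpow_pos_of_pos (ENNReal.toReal_pos (maximal_pos hΩ hf hne hxΩ).ne' hx.ne) _
  · intro Q hQ hQΩ
    obtain ⟨c, r, hr, rfl⟩ := isCube_iff_exists_closedBall.1 hQ
    obtain ⟨y, hy, hyfin⟩ : ∃ y ∈ closedBall c r, maximal Ω f y < ⊤ := by
      have h1 : ∀ᵐ x ∂(volume.restrict (closedBall c r)), maximal Ω f x < ⊤ :=
        ae_restrict_of_ae_restrict_of_subset hQΩ hfin
      have : (ae (volume.restrict (closedBall c r))).NeBot := by
        rw [ae_restrict_neBot]; exact volume_closedBall_fin_ne_zero c hr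
      exact ((ae_restrict_mem isClosed_closedBall.measurableSet).and h1).exists
    refine ⟨hmeas.aestronglyMeasurable, ?_⟩
    rw [hasFiniteIntegral_iff_ofReal
      (Eventually.of_forall fun x => Real.rpow_nonneg ENNReal.toReal_nonneg _)]
    exact (lintegral_maximal_rpow_le hΩ hf hne hδ0 hδ1 hr hQΩ hy hyfin).trans_lt
      (ENNReal.mul_lt_top (volume_closedBall_fin_ne_top c hr).lt_top ENNReal.ofReal_lt_top)
  · filter_upwards [hfin] with x hx
    refine le_of_forall_lt fun t ht => ?_
    obtain ⟨c, r, hr, hsub, hxc, ht⟩ := lt_maximal_iff.1 ht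
    refine ht.trans_le ?_
    simp only [abs_of_nonneg (Real.rpow_nonneg ENNReal.toReal_nonneg δ)]
    rw [mul_comm, ← div_eq_mul_inv, mul_assoc (1 + δ * 5 ^ n / (1 - δ)),
      ← Real.mul_rpow (by positivity) ENNReal.toReal_nonneg]
    exact ENNReal.div_le_of_le_mul'
      (lintegral_maximal_rpow_le hΩ hf hne hδ0 hδ1 hr hsub hxc hx)
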